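/- arXiv:2604.03190 — 2 statements merged into one kernel-verified Lean document; each statement's English description precedes it below -/
import Mathlib

section
/- The LayerNorm Jacobian formula: fix γ, b ∈ ℝ^d and define LN : {u ∈ ℝ^d : σ(u) > 0} → ℝ^d by LN(u)_i = γ_i (u_i − μ(u))/σ(u) + b_i. Then at any u with σ(u) > 0, LN is differentiable and its Jacobian matrix is ∂LN(u)_i/∂u_j = (γ_i / σ(u)) · ( δ_{ij} − 1/d − û_i û_j / d ), where δ_{ij} is the Kronecker delta; in matrix form the Jacobian equals (diag(γ)/σ(u)) · ( I − (1/d)𝟙𝟙ᵀ − (1/d) û ûᵀ ). (Proposition 4(b), Jacobian formula.) -/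
/-- The mean `μ(u) = (1/d) Σ_j u_j` of a vector `u ∈ ℝ^d`. -/
noncomputable def vecMean {d : ℕ} (u : Fin d → ℝ) : ℝ := (∑ j, u j) / d

/-- The standard deviation `σ(u) = sqrt((1/d) Σ_j (u_j − μ(u))²)` of a vector `u ∈ ℝ^d`. -/
noncomputable def vecStd {d : ℕ} (u : Fin d → ℝ) : ℝ :=
  Real.sqrt ((∑ j, (u j - vecMean u) ^ 2) / d)

/-- LayerNorm with scale `γ` and bias `b`: `LN(u)_i = γ_i (u_i − μ(u))/σ(u) + b_i`. -/
noncomputable def layerNorm {d : ℕ} (γ b : Fin d → ℝ) (u : Fin d → ℝ) : Fin d → ℝ :=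
  fun i => γ i * (u i - vecMean u) / vecStd u + b i

open ContinuousLinearMap in
/-- The derivative of the mean is `v ↦ μ(v)`. -/
theorem hasFDerivAt_vecMean {d : ℕ} (u : Fin d → ℝ) :
    HasFDerivAt (vecMean (d := d))
      ((d : ℝ)⁻¹ • ∑ j, proj (R := ℝ) (φ := fun _ : Fin d => ℝ) j) u := by
  have h := (HasFDerivAt.fun_sum (u := Finset.univ)
    fun (j : Fin d) _ => hasFDerivAt_apply (𝕜 := ℝ) j u).const_mul (d : ℝ)⁻¹
  refine h.congr_of_eventuallyEq (.of_forall fun v => ?_)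
  simp only [vecMean]
  ring

/-- The deviations from the mean sum to zero. -/
theorem sum_sub_vecMean {d : ℕ} (u : Fin d → ℝ) : ∑ k, (u k - vecMean u) = 0 := by
  rcases Nat.eq_zero_or_pos d with rfl | hd
  · simp
  · simp only [Finset.sum_sub_distrib, Finset.sum_const, Finset.card_univ, Fintype.card_fin,
      nsmul_eq_mul, vecMean]
    field_simp
    ring

open ContinuousLinearMap in
/-- Where `σ(u) > 0`, the derivative of the standard deviation is
`v ↦ (Σ_k (u_k − μ(u)) v_k) / (d σ(u))`. -/
theorem hasFDerivAt_vecStd {d : ℕ} {u : Fin d → ℝ} (hσ : 0 < vecStd u) :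
    HasFDerivAt (vecStd (d := d))
      ((d * vecStd u)⁻¹ •
        ∑ k, (u k - vecMean u) • proj (R := ℝ) (φ := fun _ : Fin d => ℝ) k) u := by
  have hvar : 0 < (∑ k, (u k - vecMean u) ^ 2) / d := Real.sqrt_pos.1 hσ
  have h := ((HasFDerivAt.fun_sum (u := Finset.univ) fun (k : Fin d) _ =>
    ((hasFDerivAt_apply (𝕜 := ℝ) k u).sub (hasFDerivAt_vecMean u)).pow 2).mul_const
      (d : ℝ)⁻¹).sqrt (by simpa [div_eq_mul_inv] using hvar.ne')
  refine (h.congr_fderiv ?_).congr_of_eventuallyEq (.of_forall fun v => ?_)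
  · ext v
    have hs : √((∑ k, (u k - vecMean u) ^ 2) * (d : ℝ)⁻¹) = vecStd u := by
      rw [vecStd, div_eq_mul_inv]
    have hsum : ∑ k, (u k - vecMean u) * (v k - (d : ℝ)⁻¹ * ∑ j, v j) =
        ∑ k, (u k - vecMean u) * v k := by
      simp only [mul_sub, Finset.sum_sub_distrib, ← Finset.sum_mul]
      rw [← Finset.sum_sub_distrib, sum_sub_vecMean]
      ring
    simp only [Pi.sub_apply, hs, smul_apply, sum_apply, sub_apply, proj_apply, smul_eq_mul,
      nsmul_eq_mul, Nat.cast_ofNat, Nat.add_one_sub_one, pow_one, mul_assoc,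
      ← Finset.mul_sum, hsum, mul_inv]
    field_simp
  · simp [vecStd, div_eq_mul_inv]

open ContinuousLinearMap in
/-- The derivative of a coordinate of LayerNorm, by the quotient rule. -/
theorem hasFDerivAt_layerNorm_apply {d : ℕ} (γ b : Fin d → ℝ) {u : Fin d → ℝ}
    (hσ : 0 < vecStd u) (i : Fin d) :
    HasFDerivAt (fun v => layerNorm γ b v i)
      ((γ i / vecStd u) • (proj (R := ℝ) (φ := fun _ : Fin d => ℝ) i -
        (d : ℝ)⁻¹ • ∑ j, proj j -
        ((u i - vecMean u) / (d * vecStd u ^ 2)) • ∑ k, (u k - vecMean u) • proj k)) u := by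
  have h := (((hasFDerivAt_apply (𝕜 := ℝ) i u).sub (hasFDerivAt_vecMean u)).const_mul
    (γ i)).mul ((hasDerivAt_inv hσ.ne').comp_hasFDerivAt u (hasFDerivAt_vecStd hσ))
  refine ((h.add_const (b i)).congr_fderiv ?_).congr_of_eventuallyEq (.of_forall fun v => ?_)
  · ext v
    simp only [Pi.sub_apply, Function.comp_apply, add_apply, smul_apply, sum_apply, sub_apply,
      proj_apply, smul_eq_mul]
    field_simp
    ring
  · simp [layerNorm, div_eq_mul_inv]

/-- Proposition 4(b), Jacobian formula: at any `u` with `σ(u) > 0`, LayerNorm is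
differentiable and its Jacobian entries are
`∂LN(u)_i/∂u_j = (γ_i/σ(u)) (δ_{ij} − 1/d − û_i û_j / d)` where
`û = (u − μ(u)𝟙)/σ(u)` is the standardized vector. -/
theorem layerNorm_jacobian
    (d : ℕ) (hd : 1 ≤ d) (γ b : Fin d → ℝ) (u : Fin d → ℝ) (hσ : 0 < vecStd u) :
    DifferentiableAt ℝ (layerNorm γ b) u ∧
    ∀ i j : Fin d,
      fderiv ℝ (layerNorm γ b) u (Pi.single j 1) i =
        (γ i / vecStd u) *
          ((if i = j then (1 : ℝ) else 0) - 1 / d -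
            ((u i - vecMean u) / vecStd u) * ((u j - vecMean u) / vecStd u) / d) := by
  have h : HasFDerivAt (layerNorm γ b) _ u :=
    hasFDerivAt_pi.2 fun i => hasFDerivAt_layerNorm_apply γ b hσ i
  refine ⟨h.differentiableAt, fun i j => ?_⟩
  rw [h.fderiv]
  simp only [ContinuousLinearMap.pi_apply, smul_apply,
    sub_apply, sum_apply, ContinuousLinearMap.proj_apply,
    smul_eq_mul, Pi.single_apply, Finset.sum_ite_eq', Finset.mem_univ,
    if_true, mul_ite, mul_one, mul_zero]
  field_simp
end

section
/- The Hopfield update is the gradient step of the Hopfield energy: define E(ξ) = −(1/β) log( Σ_{i=1}^N exp(β ⟨x_i, ξ⟩) ) + (1/2)‖ξ‖². Then E is differentiable at every ξ ∈ ℝ^d and its gradient is ∇E(ξ) = ξ − X · softmax(β Xᵀ ξ); consequently ξ − ∇E(ξ) = T(ξ), i.e., the update rule ξ_new = −∇E(ξ) + ξ coincides with the Hopfield update T. -/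
/-- Softmax of a vector `z ∈ ℝ^N`: `softmax(z)_i = exp(z_i) / Σ_j exp(z_j)`. -/
noncomputable def softmax {N : ℕ} (z : Fin N → ℝ) : Fin N → ℝ :=
  fun i => Real.exp (z i) / ∑ j, Real.exp (z j)

/-- Hopfield update `T(ξ) = X · softmax(β Xᵀ ξ)`. -/
noncomputable def hopfieldUpdate {d N : ℕ} (X : Matrix (Fin d) (Fin N) ℝ) (β : ℝ)
    (ξ : Fin d → ℝ) : Fin d → ℝ :=
  X.mulVec (softmax (β • X.transpose.mulVec ξ))

/-- The gradient of the scaled log-sum-exp of finitely many linear forms is the softmax-weighted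
average of the vectors representing them. -/
theorem hasGradientAt_inv_mul_log_sum_exp_inner {ι F : Type*} [Fintype ι] [Nonempty ι]
    [NormedAddCommGroup F] [InnerProductSpace ℝ F] [CompleteSpace F] (v : ι → F) {β : ℝ}
    (hβ : β ≠ 0) (ξ : F) :
    HasGradientAt (fun ξ => 1 / β * Real.log (∑ i, Real.exp (β * inner ℝ (v i) ξ)))
      (∑ i, (Real.exp (β * inner ℝ (v i) ξ) / ∑ k, Real.exp (β * inner ℝ (v k) ξ)) • v i) ξ := by
  have hsum : (∑ i, Real.exp (β * inner ℝ (v i) ξ)) ≠ 0 :=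
    (Finset.sum_pos (fun i _ => Real.exp_pos _) Finset.univ_nonempty).ne'
  have hexp (i : ι) := (((innerSL ℝ (v i)).hasFDerivAt (x := ξ)).const_mul β).exp
  rw [hasGradientAt_iff_hasFDerivAt]
  refine (((HasFDerivAt.fun_sum fun i _ => hexp i).log hsum).const_mul (1 / β)).congr_fderiv ?_
  ext y
  simp only [smul_apply, sum_apply, innerSL_apply_apply,
    InnerProductSpace.toDual_apply_apply, sum_inner, real_inner_smul_left, smul_eq_mul,
    Finset.mul_sum]
  refine Finset.sum_congr rfl fun i _ => ?_
  field_simp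

/-- The gradient of half the squared norm is the identity. -/
theorem hasGradientAt_half_norm_sq {F : Type*} [NormedAddCommGroup F] [InnerProductSpace ℝ F]
    [CompleteSpace F] (ξ : F) : HasGradientAt (fun ξ : F => (1 / 2 : ℝ) * ‖ξ‖ ^ 2) ξ ξ := by
  rw [hasGradientAt_iff_hasFDerivAt]
  refine ((hasStrictFDerivAt_norm_sq ξ).hasFDerivAt.const_mul (1 / 2 : ℝ)).congr_fderiv ?_
  ext y
  simp

/-- The Hopfield energy `E(ξ) = −(1/β) log Σ_i exp(β⟨x_i, ξ⟩) + ½‖ξ‖²` is differentiable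
at every `ξ ∈ ℝ^d` with gradient `∇E(ξ) = ξ − X softmax(β Xᵀ ξ)`; consequently the
gradient step `ξ − ∇E(ξ)` coincides with the Hopfield update `T(ξ)`.
(Here `ℝ^d` is the Euclidean space `EuclideanSpace ℝ (Fin d)`, identified with
`Fin d → ℝ` via `WithLp.equiv`, and column `i` of `X` is `fun j => X j i`, so that
`⟨x_i, ξ⟩ = Σ_j X j i * ξ j`.) -/
theorem hopfield_energy_gradient
    (d N : ℕ) (hN : 0 < N) (X : Matrix (Fin d) (Fin N) ℝ) (β : ℝ) (hβ : 0 < β)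
    (ξ : EuclideanSpace ℝ (Fin d)) :
    HasGradientAt
      (fun ξ : EuclideanSpace ℝ (Fin d) =>
        -(1 / β) * Real.log (∑ i, Real.exp (β * ∑ j, X j i * ξ j))
          + (1 / 2 : ℝ) * ‖ξ‖ ^ 2)
      ((WithLp.equiv 2 (Fin d → ℝ)).symm
        (WithLp.equiv 2 (Fin d → ℝ) ξ - hopfieldUpdate X β (WithLp.equiv 2 (Fin d → ℝ) ξ)))
      ξ ∧
    WithLp.equiv 2 (Fin d → ℝ) ξ -
        (WithLp.equiv 2 (Fin d → ℝ) ξ - hopfieldUpdate X β (WithLp.equiv 2 (Fin d → ℝ) ξ))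
      = hopfieldUpdate X β (WithLp.equiv 2 (Fin d → ℝ) ξ) := by
  refine ⟨?_, sub_sub_cancel _ _⟩
  have : Nonempty (Fin N) := ⟨⟨0, hN⟩⟩
  let v (i : Fin N) : EuclideanSpace ℝ (Fin d) := WithLp.toLp 2 fun j => X j i
  have hv (i : Fin N) (ζ : EuclideanSpace ℝ (Fin d)) : inner ℝ (v i) ζ = ∑ j, X j i * ζ j := by
    simp [v, PiLp.inner_apply, mul_comm]
  have hlog := (hasGradientAt_inv_mul_log_sum_exp_inner v hβ.ne' ξ).hasFDerivAt
  have hnorm := (hasGradientAt_half_norm_sq ξ).hasFDerivAt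
  have hsub := hnorm.fun_sub hlog
  rw [← map_sub, ← hasGradientAt_iff_hasFDerivAt] at hsub
  simp only [hv] at hsub
  convert hsub using 1
  · funext ζ
    ring
  · ext j
    simp [v, hopfieldUpdate, softmax, Matrix.mulVec, dotProduct, mul_comm]
end
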